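/- Let F be a field of characteristic zero, let C be a subfield of F, let p = (p₁,…,p_m) ∈ F^m, and let z = (z₁,…,zₙ) ∈ Fⁿ. Then the transcendence degree of the field generated by C ∪ {p₁,…,p_m, z₁,…,zₙ} over the field generated by C ∪ {p₁,…,p_m} is at most ldim_{ℚ(p)}({z₁,…,zₙ}/C), where ℚ(p) denotes the subfield of F generated by p₁,…,p_m. -/

import Mathlib

/-- `td X Y` : the transcendence degree of the field `ℚ(X ∪ Y)` over `ℚ(Y)`,
realized as the supremum of the cardinalities of subsets of `ℚ(X ∪ Y)` that are
algebraically independent over `ℚ(Y)`. -/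
noncomputable def td {F : Type*} [Field F] (X Y : Set F) : Cardinal :=
  ⨆ s : {s : Set F // s ⊆ ↑(Subfield.closure (X ∪ Y)) ∧
      AlgebraicIndependent ↥(Subfield.closure Y) ((↑) : s → F)}, Cardinal.mk s.1

/-- `ldim K X Y` : the dimension of the `K`-vector space `span_K(X ∪ Y) / span_K(Y)`,
realized as the rank of the image of `span_K(X ∪ Y)` in `F / span_K(Y)`. -/
noncomputable def ldim (K : Type*) {F : Type*} [DivisionRing K] [AddCommGroup F]
    [Module K F] (X Y : Set F) : ℕ :=
  Module.finrank K
    (Submodule.map (Submodule.span K Y).mkQ (Submodule.span K (X ∪ Y)))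

/-- A finite set `X` lies in the `K`-span of `Y` and some `ldim K X Y` further elements. -/
theorem exists_subset_span_union_range_ldim {K F : Type*} [DivisionRing K] [AddCommGroup F]
    [Module K F] {X : Set F} (hX : X.Finite) (Y : Set F) :
    ∃ w : Fin (ldim K X Y) → F, X ⊆ Submodule.span K (Y ∪ Set.range w) := by
  set V := Submodule.map (Submodule.span K Y).mkQ (Submodule.span K (X ∪ Y)) with hV
  have hVX : V = Submodule.span K ((Submodule.span K Y).mkQ '' X) := by
    have hker : Submodule.map (Submodule.span K Y).mkQ (Submodule.span K Y) = ⊥ :=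
      Submodule.mkQ_map_self _
    rw [hV, Submodule.span_union, Submodule.map_sup, hker, sup_bot_eq, Submodule.map_span]
  have : Module.Finite K V := by
    rw [hVX]
    exact Module.Finite.span_of_finite K (hX.image _)
  let b := Module.finBasis K V
  choose w hw using fun i => Submodule.mkQ_surjective (Submodule.span K Y) (b i : F ⧸ _)
  refine ⟨w, fun x hx => ?_⟩
  have hle : V ≤ Submodule.map (Submodule.span K Y).mkQ (Submodule.span K (Set.range w)) := by
    rw [Submodule.map_span, ← Set.range_comp]
    have hwb : ⇑(Submodule.span K Y).mkQ ∘ w = V.subtype ∘ b := funext hw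
    rw [hwb, Set.range_comp, ← Submodule.map_span, b.span_eq, Submodule.map_top,
      Submodule.range_subtype]
  have hxV : x ∈ Submodule.comap (Submodule.span K Y).mkQ V :=
    Submodule.mem_map_of_mem (Submodule.subset_span (Or.inl hx))
  have := Submodule.comap_mono hle hxV
  rwa [Submodule.comap_map_mkQ, ← Submodule.span_union] at this

open scoped IntermediateField.algebraAdjoinAdjoin in
/-- An algebraically independent subset of `L(S)` has at most `#S` elements. -/
theorem encard_le_of_algebraicIndepOn_of_subset_adjoin {L F : Type*} [Field L] [Field F]
    [Algebra L F] {s S : Set F} (hs : AlgebraicIndepOn L id s)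
    (hsS : s ⊆ IntermediateField.adjoin L S) : s.encard ≤ S.encard := by
  have hcl : s ⊆ (AlgebraicIndependent.matroid L F).closure S := by
    intro a ha
    rw [AlgebraicIndependent.matroid_closure_eq]
    exact (IsFractionRing.isAlgebraic_iff (Algebra.adjoin L S) (IntermediateField.adjoin L S) F).2
      (isAlgebraic_algebraMap (⟨a, hsS ha⟩ : IntermediateField.adjoin L S))
  calc s.encard = (AlgebraicIndependent.matroid L F).eRk s :=
        (AlgebraicIndependent.matroid_indep_iff.2 hs).eRk_eq_encard.symm
    _ ≤ (AlgebraicIndependent.matroid L F).eRk S := by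
        rw [← Matroid.eRk_closure_eq _ S]
        exact Matroid.eRk_mono _ hcl
    _ ≤ S.encard := Matroid.eRk_le_encard _ _

/-- Inequality (3): `td(z / C ∪ p) ≤ ldim_{ℚ(p)}(z / C)` in any characteristic zero
field. -/
theorem td_le_ldim_adjoin_powers {F : Type*} [Field F] [CharZero F] (C : Subfield F)
    (m n : ℕ) (p : Fin m → F) (z : Fin n → F) :
    td (Set.range z) ((C : Set F) ∪ Set.range p)
      ≤ (ldim ↥(Subfield.closure (Set.range p)) (Set.range z) (C : Set F) : Cardinal) := by
  set L := Subfield.closure ((C : Set F) ∪ Set.range p)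
  obtain ⟨w, hw⟩ := exists_subset_span_union_range_ldim
    (K := Subfield.closure (Set.range p)) (Set.finite_range z) (C : Set F)
  have hpL : Subfield.closure (Set.range p) ≤ L := Subfield.closure_mono Set.subset_union_right
  have hL (x : F) (hx : x ∈ L) : x ∈ IntermediateField.adjoin L (Set.range w) :=
    (IntermediateField.adjoin L (Set.range w)).algebraMap_mem ⟨x, hx⟩
  have hz : Set.range z ⊆ IntermediateField.adjoin L (Set.range w) := by
    refine hw.trans fun x hx => ?_
    induction hx using Submodule.span_induction with
    | mem x hx =>
      rcases hx with hx | hx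
      · exact hL x (Subfield.subset_closure (Or.inl hx))
      · exact IntermediateField.subset_adjoin L _ hx
    | zero => exact zero_mem _
    | add x y _ _ hx hy => exact add_mem hx hy
    | smul a x _ hx => exact mul_mem (hL a (hpL a.2)) hx
  have hle : Subfield.closure (Set.range z ∪ ((C : Set F) ∪ Set.range p)) ≤
      (IntermediateField.adjoin L (Set.range w)).toSubfield :=
    Subfield.closure_le.2 (Set.union_subset hz fun x hx => hL x (Subfield.subset_closure hx))
  refine ciSup_le' fun s => ?_
  rw [← Cardinal.toENat_le_natCast, Set.toENat_cardinalMk]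
  calc s.1.encard ≤ (Set.range w).encard :=
        encard_le_of_algebraicIndepOn_of_subset_adjoin (L := L) s.2.2 (s.2.1.trans hle)
    _ ≤ (Set.univ : Set (Fin _)).encard := by
        rw [← Set.image_univ]
        exact Set.encard_image_le _ _
    _ = _ := by simp
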